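/- arXiv:2112.06686 — 7 statements merged into one kernel-verified Lean document; each statement's English description precedes it below -/
import Mathlib

section
/- Let 𝔤 be a real Lie algebra and ∇ a flat connection on 𝔤. Equip 𝔤 ⊕ 𝔤 with the Lie bracket [X₁⊕Y₁, X₂⊕Y₂] = [X₁,X₂] ⊕ (∇_{X₁}Y₂ − ∇_{X₂}Y₁) (the semidirect product 𝔤 ⋉_∇ 𝔤ₐ), and define the linear map I : 𝔤 ⊕ 𝔤 → 𝔤 ⊕ 𝔤 by I(X⊕Y) = (−Y)⊕X. Then the Nijenhuis tensor N_I(A,B) = [A,B] + I[IA,B] + I[A,IB] − [IA,IB] vanishes identically on 𝔤 ⋉_∇ 𝔤ₐ if and only if ∇ is torsion-free, i.e. ∇_X Y − ∇_Y X = [X,Y] for all X,Y ∈ 𝔤. -/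
variable {L : Type*} [LieRing L] [LieAlgebra ℝ L]

/-- The bracket `[X₁⊕Y₁, X₂⊕Y₂] = [X₁,X₂] ⊕ (∇_{X₁}Y₂ − ∇_{X₂}Y₁)` on `𝔤 ⊕ 𝔤`
induced by a connection (bilinear map) `∇` on `𝔤`. -/
def semiBracket (nabla : L →ₗ[ℝ] L →ₗ[ℝ] L) (A B : L × L) : L × L :=
  (⁅A.1, B.1⁆, nabla A.1 B.2 - nabla B.1 A.2)

/-- The almost complex structure `I(X⊕Y) = (−Y)⊕X` on `𝔤 ⊕ 𝔤`. -/
def Iop (A : L × L) : L × L := (-A.2, A.1)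

/-- The Nijenhuis tensor `N_I(A,B) = [A,B] + I[IA,B] + I[A,IB] − [IA,IB]`
of `I` on `𝔤 ⋉_∇ 𝔤ₐ`. -/
def nijenhuis (nabla : L →ₗ[ℝ] L →ₗ[ℝ] L) (A B : L × L) : L × L :=
  semiBracket nabla A B + Iop (semiBracket nabla (Iop A) B)
    + Iop (semiBracket nabla A (Iop B)) - semiBracket nabla (Iop A) (Iop B)

/-- For a flat connection `∇`, the Nijenhuis tensor of `I` on `𝔤 ⋉_∇ 𝔤ₐ` vanishes
iff `∇` is torsion-free. -/
theorem nijenhuis_eq_zero_iff_torsionFree (nabla : L →ₗ[ℝ] L →ₗ[ℝ] L)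
    (hflat : ∀ X Y Z : L,
      nabla X (nabla Y Z) - nabla Y (nabla X Z) - nabla ⁅X, Y⁆ Z = 0) :
    (∀ A B : L × L, nijenhuis nabla A B = 0)
      ↔ (∀ X Y : L, nabla X Y - nabla Y X = ⁅X, Y⁆) := by
  constructor
  · intro h X Y
    have h1 := congrArg Prod.fst (h (X, 0) (Y, 0))
    simp [nijenhuis, semiBracket, Iop] at h1
    rw [← sub_eq_zero, ← neg_eq_zero, ← h1]
    abel
  · rintro h ⟨a, b⟩ ⟨c, d⟩
    ext
    · simp [nijenhuis, semiBracket, Iop, ← h]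
      abel
    · simp [nijenhuis, semiBracket, Iop, ← h]
      abel
end

section
/- Let (𝔤, ∇, g) be a Hessian Lie algebra with g positive definite. On the semidirect product 𝔤 ⋉_∇ 𝔤ₐ define I(X⊕Y) = (−Y)⊕X, π(X⊕Y) = X, and the alternating bilinear form ω(P,Q) = g(π(IP), π(Q)) − g(π(P), π(IQ)). Then: (1) ω is closed for the Chevalley–Eilenberg differential, i.e. dω(V₁,V₂,V₃) = −ω([V₁,V₂],V₃) + ω([V₁,V₃],V₂) − ω([V₂,V₃],V₁) = 0 for all V₁,V₂,V₃ ∈ 𝔤 ⊕ 𝔤; and (2) the bilinear form (P,Q) ↦ ω(P, IQ) is symmetric and positive definite. (Together with integrability of I, this makes 𝔤 ⋉_∇ 𝔤ₐ a Kähler Lie algebra.) -/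
variable {L : Type*} [LieRing L] [LieAlgebra ℝ L]

/-- The projection `π(X⊕Y) = X`. -/
def piL (A : L × L) : L := A.1

/-- The 2-form `ω(P,Q) = g(π(IP), π(Q)) − g(π(P), π(IQ))` on `𝔤 ⊕ 𝔤`. -/
def omegaForm (g : L →ₗ[ℝ] L →ₗ[ℝ] ℝ) (P Q : L × L) : ℝ :=
  g (piL (Iop P)) (piL Q) - g (piL P) (piL (Iop Q))

/-- On a Hessian Lie algebra `(𝔤, ∇, g)` with `g` positive definite, the form `ω`
on `𝔤 ⋉_∇ 𝔤ₐ` is closed (for the Chevalley–Eilenberg differential), and `ω(·, I·)`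
is symmetric and positive definite. -/
theorem hessian_gives_kaehler (nabla : L →ₗ[ℝ] L →ₗ[ℝ] L) (g : L →ₗ[ℝ] L →ₗ[ℝ] ℝ)
    (hflat : ∀ X Y Z : L,
      nabla X (nabla Y Z) - nabla Y (nabla X Z) - nabla ⁅X, Y⁆ Z = 0)
    (htf : ∀ X Y : L, nabla X Y - nabla Y X = ⁅X, Y⁆)
    (hgsym : ∀ X Y : L, g X Y = g Y X)
    (hgpos : ∀ X : L, X ≠ 0 → 0 < g X X)
    (hcodazzi : ∀ X Y Z : L,
      g (nabla X Y) Z + g Y (nabla X Z) = g (nabla Y X) Z + g X (nabla Y Z)) :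
    (∀ V₁ V₂ V₃ : L × L,
      -omegaForm g (semiBracket nabla V₁ V₂) V₃
        + omegaForm g (semiBracket nabla V₁ V₃) V₂
        - omegaForm g (semiBracket nabla V₂ V₃) V₁ = 0)
    ∧ (∀ P Q : L × L, omegaForm g P (Iop Q) = omegaForm g Q (Iop P))
    ∧ (∀ P : L × L, P ≠ 0 → 0 < omegaForm g P (Iop P)) := by
  refine ⟨?_, ?_, ?_⟩
  · rintro ⟨X₁, Y₁⟩ ⟨X₂, Y₂⟩ ⟨X₃, Y₃⟩
    have h₁ := hcodazzi X₂ X₃ Y₁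
    have h₂ := hcodazzi X₁ X₃ Y₂
    have h₃ := hcodazzi X₁ X₂ Y₃
    simp only [omegaForm, semiBracket, Iop, piL, ← htf, map_neg, map_sub,
      LinearMap.neg_apply, LinearMap.sub_apply]
    rw [hgsym X₃, hgsym X₂] at h₁
    rw [hgsym X₃, hgsym X₁] at h₂
    rw [hgsym X₂, hgsym X₁] at h₃
    linarith
  · intro P Q
    simp only [omegaForm, Iop, piL, map_neg, LinearMap.neg_apply]
    rw [hgsym P.1, hgsym P.2]
  · rintro ⟨X, Y⟩ hP
    have nonneg (Z : L) : 0 ≤ g Z Z := by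
      rcases eq_or_ne Z 0 with rfl | hZ
      · simp
      · exact (hgpos Z hZ).le
    simp only [omegaForm, Iop, piL, map_neg, LinearMap.neg_apply]
    by_cases hX : X = 0
    · have hY : Y ≠ 0 := fun hY => hP (by simp [hX, hY])
      linarith [nonneg X, hgpos Y hY]
    · linarith [nonneg Y, hgpos X hX]
end

section
/- Let (𝔤, g, D) be a statistical Lie algebra of constant curvature c ∈ ℝ. Let 𝔥 = 𝔤 × ℝ be the product Lie algebra (with ℝ the abelian Lie algebra, so [(X,a),(Y,b)] = ([X,Y],0)), and set ρ = (0,1) ∈ 𝔥. Define the connection ∇ on 𝔥 by bilinear extension of: ∇_X Y = D_X Y − c·g(X,Y)·ρ for X,Y ∈ 𝔤, ∇_X ρ = ∇_ρ X = X for X ∈ 𝔤, and ∇_ρ ρ = ρ. Then ∇ is a flat torsion-free connection on 𝔥, i.e. ∇_A B − ∇_B A = [A,B] and ∇_A(∇_B C) − ∇_B(∇_A C) − ∇_{[A,B]}C = 0 for all A,B,C ∈ 𝔥. -/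
variable {L : Type*} [LieRing L] [LieAlgebra ℝ L]

/-- The connection `∇` on `𝔥 = 𝔤 × ℝ` given by the bilinear extension of
`∇_X Y = D_X Y − c·g(X,Y)·ρ`, `∇_X ρ = ∇_ρ X = X`, `∇_ρ ρ = ρ`, where `ρ = (0,1)`. -/
def nablaH (D : L →ₗ[ℝ] L →ₗ[ℝ] L) (g : L →ₗ[ℝ] L →ₗ[ℝ] ℝ) (c : ℝ)
    (A B : L × ℝ) : L × ℝ :=
  (D A.1 B.1 + B.2 • A.1 + A.2 • B.1, A.2 * B.2 - c * g A.1 B.1)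

/-- For a statistical Lie algebra `(𝔤, g, D)` of constant curvature `c`, the connection
`∇` on the product Lie algebra `𝔥 = 𝔤 × ℝ` (with bracket `[(X,a),(Y,b)] = ([X,Y],0)`)
is flat and torsion-free. -/
theorem nablaH_flat_torsionFree (c : ℝ)
    (D : L →ₗ[ℝ] L →ₗ[ℝ] L) (g : L →ₗ[ℝ] L →ₗ[ℝ] ℝ)
    (hgsym : ∀ X Y : L, g X Y = g Y X)
    (hgpos : ∀ X : L, X ≠ 0 → 0 < g X X)
    (hDtf : ∀ X Y : L, D X Y - D Y X = ⁅X, Y⁆)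
    (hDcodazzi : ∀ X Y Z : L,
      g (D X Y) Z + g Y (D X Z) = g (D Y X) Z + g X (D Y Z))
    (hDcurv : ∀ X Y Z : L,
      D X (D Y Z) - D Y (D X Z) - D ⁅X, Y⁆ Z = c • (g Y Z • X - g X Z • Y)) :
    (∀ A B : L × ℝ,
      nablaH D g c A B - nablaH D g c B A = (⁅A.1, B.1⁆, (0 : ℝ)))
    ∧ (∀ A B C : L × ℝ,
      nablaH D g c A (nablaH D g c B C) - nablaH D g c B (nablaH D g c A C)
        - nablaH D g c (⁅A.1, B.1⁆, (0 : ℝ)) C = 0) := by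
  refine ⟨?_, ?_⟩
  · rintro ⟨X, a⟩ ⟨Y, b⟩
    ext
    · simp only [nablaH, Prod.fst_sub, ← hDtf]
      module
    · simp only [nablaH, Prod.snd_sub, hgsym Y X]
      ring
  · rintro ⟨X, a⟩ ⟨Y, b⟩ ⟨Z, e⟩
    ext
    · have hcurv := hDcurv X Y Z
      rw [sub_eq_iff_eq_add, sub_eq_iff_eq_add] at hcurv
      simp only [nablaH, Prod.fst_sub, Prod.fst_zero, map_add, map_smul, hcurv]
      rw [← hDtf X Y]
      module
    · have hcod := hDcodazzi X Y Z
      simp only [nablaH, Prod.snd_sub, Prod.snd_zero, map_add, map_smul, smul_eq_mul, hgsym Y X]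
      rw [← hDtf X Y]
      simp only [map_sub, LinearMap.sub_apply]
      linear_combination c * hcod
end

section
/- Let (𝔤, g, D) be a statistical Lie algebra of constant curvature c ∈ ℝ, 𝔥 = 𝔤 × ℝ, ρ = (0,1) ∈ 𝔥, and ∇ the flat torsion-free connection on 𝔥 given by ∇_X Y = D_X Y − c·g(X,Y)·ρ, ∇_X ρ = ∇_ρ X = X, ∇_ρ ρ = ρ (X,Y ∈ 𝔤). On 𝔥 ⋉_∇ 𝔥ₐ define I(A⊕B) = (−B)⊕A, the projection π(( X,a)⊕(Y,b)) = X ∈ 𝔤, the linear functionals ρ¹((X,a)⊕(Y,b)) = a and ρ²((X,a)⊕(Y,b)) = b, the form ω(P,Q) = g(π(IP), π(Q)) − g(π(P), π(IQ)), and for t ∈ ℝ the form ω_t = ω + t·ρ¹∧ρ². Then for every t ∈ ℝ: (1) dρ¹ = 0, i.e. ρ¹([P,Q]) = 0 for all P,Q ∈ 𝔥 ⊕ 𝔥; and (2) dω_t = −(1+ct)·ρ¹∧ω_t, where d is the Chevalley–Eilenberg differential. In particular (𝔥 ⋉_∇ 𝔥ₐ, I, ω_t, −(1+ct)ρ¹)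 is a locally conformally Kähler Lie algebra for t > 0. -/
variable {L : Type*} [LieRing L] [LieAlgebra ℝ L]

/-- The bracket of the semidirect product `𝔥 ⋉_∇ 𝔥ₐ` on `𝔥 ⊕ 𝔥`:
`[A₁⊕B₁, A₂⊕B₂] = [A₁,A₂] ⊕ (∇_{A₁}B₂ − ∇_{A₂}B₁)`. -/
def brH (D : L →ₗ[ℝ] L →ₗ[ℝ] L) (g : L →ₗ[ℝ] L →ₗ[ℝ] ℝ) (c : ℝ)
    (P Q : (L × ℝ) × (L × ℝ)) : (L × ℝ) × (L × ℝ) :=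
  ((⁅P.1.1, Q.1.1⁆, (0 : ℝ)), nablaH D g c P.1 Q.2 - nablaH D g c Q.1 P.2)

/-- The almost complex structure `I(A⊕B) = (−B)⊕A` on `𝔥 ⊕ 𝔥`. -/
def IopH (P : (L × ℝ) × (L × ℝ)) : (L × ℝ) × (L × ℝ) := (-P.2, P.1)

/-- The projection `π((X,a)⊕(Y,b)) = X`. -/
def piH (P : (L × ℝ) × (L × ℝ)) : L := P.1.1

/-- The functional `ρ¹((X,a)⊕(Y,b)) = a`. -/
def rhoOne (P : (L × ℝ) × (L × ℝ)) : ℝ := P.1.2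

/-- The functional `ρ²((X,a)⊕(Y,b)) = b`. -/
def rhoTwo (P : (L × ℝ) × (L × ℝ)) : ℝ := P.2.2

/-- The 2-form `ω(P,Q) = g(π(IP), π(Q)) − g(π(P), π(IQ))`. -/
def omegaH (g : L →ₗ[ℝ] L →ₗ[ℝ] ℝ) (P Q : (L × ℝ) × (L × ℝ)) : ℝ :=
  g (piH (IopH P)) (piH Q) - g (piH P) (piH (IopH Q))

/-- The 2-form `ω_t = ω + t·ρ¹∧ρ²`. -/
def omegaT (g : L →ₗ[ℝ] L →ₗ[ℝ] ℝ) (t : ℝ) (P Q : (L × ℝ) × (L × ℝ)) : ℝ :=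
  omegaH g P Q + t * (rhoOne P * rhoTwo Q - rhoOne Q * rhoTwo P)

/-- For a statistical Lie algebra `(𝔤, g, D)` of constant curvature `c` and any `t ∈ ℝ`:
`ρ¹` is closed on `𝔥 ⋉_∇ 𝔥ₐ`, and `dω_t = −(1+ct)·ρ¹∧ω_t` for the Chevalley–Eilenberg
differential; so `(𝔥 ⋉_∇ 𝔥ₐ, I, ω_t, −(1+ct)ρ¹)` is an l.c.K. Lie algebra for `t > 0`. -/
theorem lck_structure (c : ℝ)
    (D : L →ₗ[ℝ] L →ₗ[ℝ] L) (g : L →ₗ[ℝ] L →ₗ[ℝ] ℝ)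
    (hgsym : ∀ X Y : L, g X Y = g Y X)
    (hgpos : ∀ X : L, X ≠ 0 → 0 < g X X)
    (hDtf : ∀ X Y : L, D X Y - D Y X = ⁅X, Y⁆)
    (hDcodazzi : ∀ X Y Z : L,
      g (D X Y) Z + g Y (D X Z) = g (D Y X) Z + g X (D Y Z))
    (hDcurv : ∀ X Y Z : L,
      D X (D Y Z) - D Y (D X Z) - D ⁅X, Y⁆ Z = c • (g Y Z • X - g X Z • Y))
    (t : ℝ) :
    (∀ P Q : (L × ℝ) × (L × ℝ), rhoOne (brH D g c P Q) = 0)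
    ∧ (∀ V₁ V₂ V₃ : (L × ℝ) × (L × ℝ),
      -omegaT g t (brH D g c V₁ V₂) V₃
        + omegaT g t (brH D g c V₁ V₃) V₂
        - omegaT g t (brH D g c V₂ V₃) V₁
      = -(1 + c * t) *
          (rhoOne V₁ * omegaT g t V₂ V₃ - rhoOne V₂ * omegaT g t V₁ V₃
            + rhoOne V₃ * omegaT g t V₁ V₂)) := by
  refine ⟨fun _ _ => rfl, ?_⟩
  rintro ⟨⟨X₁, a₁⟩, ⟨Y₁, b₁⟩⟩ ⟨⟨X₂, a₂⟩, ⟨Y₂, b₂⟩⟩ ⟨⟨X₃, a₃⟩, ⟨Y₃, b₃⟩⟩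
  have h₁₂ := hDcodazzi X₁ X₂ Y₃
  have h₁₃ := hDcodazzi X₁ X₃ Y₂
  have h₂₃ := hDcodazzi X₂ X₃ Y₁
  simp only [omegaT, omegaH, brH, nablaH, IopH, piH, rhoOne, rhoTwo, ← hDtf, Prod.fst_sub,
    Prod.snd_sub, Prod.fst_neg, map_add, map_sub, map_neg, map_smul, LinearMap.add_apply,
    LinearMap.sub_apply, LinearMap.neg_apply, LinearMap.smul_apply, smul_eq_mul]
  rw [hgsym X₂ (D X₁ Y₃), hgsym X₁ (D X₂ Y₃)] at h₁₂
  rw [hgsym X₃ (D X₁ Y₂), hgsym X₁ (D X₃ Y₂)] at h₁₃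
  rw [hgsym X₃ (D X₂ Y₁), hgsym X₂ (D X₃ Y₁)] at h₂₃
  rw [hgsym Y₁ X₂, hgsym Y₁ X₃, hgsym Y₂ X₁, hgsym Y₂ X₃, hgsym Y₃ X₁, hgsym Y₃ X₂,
    hgsym X₂ X₁, hgsym X₃ X₁, hgsym X₃ X₂]
  linear_combination -h₁₂ + h₁₃ - h₂₃
end

section
/- Let (𝔤, g, D) be a statistical Lie algebra of constant curvature c ∈ ℝ, 𝔥 = 𝔤 × ℝ, ρ = (0,1) ∈ 𝔥, and ∇ the connection on 𝔥 given by ∇_X Y = D_X Y − c·g(X,Y)·ρ, ∇_X ρ = ∇_ρ X = X, ∇_ρ ρ = ρ (X,Y ∈ 𝔤). On 𝔥 ⊕ 𝔥 define I(A⊕B) = (−B)⊕A, π((X,a)⊕(Y,b)) = X, ρ¹((X,a)⊕(Y,b)) = a, ρ²((X,a)⊕(Y,b)) = b, ω(P,Q) = g(π(IP), π(Q)) − g(π(P), π(IQ)), and ω_t = ω + t·ρ¹∧ρ². Then for every t > 0 the bilinear form (P,Q) ↦ ω_t(P, IQ) on 𝔥 ⊕ 𝔥 is symmetric and positive definite.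 -/
variable {L : Type*} [LieRing L] [LieAlgebra ℝ L]

/-- `ω_t(P, IQ)` is the orthogonal sum of two copies of `g` and two copies of `t` times the
standard form on `ℝ`. -/
theorem omegaT_Iop_eq (g : L →ₗ[ℝ] L →ₗ[ℝ] ℝ) (t : ℝ) (P Q : (L × ℝ) × (L × ℝ)) :
    omegaT g t P (IopH Q) =
      g P.1.1 Q.1.1 + g P.2.1 Q.2.1 + t * (P.1.2 * Q.1.2 + P.2.2 * Q.2.2) := by
  simp [omegaT, omegaH, IopH, piH, rhoOne, rhoTwo]
  ring

/-- For a statistical Lie algebra `(𝔤, g, D)` of constant curvature `c` and any `t > 0`,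
the bilinear form `(P,Q) ↦ ω_t(P, IQ)` on `𝔥 ⊕ 𝔥` is symmetric and positive definite. -/
theorem omegaT_Iop_posDef (c : ℝ)
    (D : L →ₗ[ℝ] L →ₗ[ℝ] L) (g : L →ₗ[ℝ] L →ₗ[ℝ] ℝ)
    (hgsym : ∀ X Y : L, g X Y = g Y X)
    (hgpos : ∀ X : L, X ≠ 0 → 0 < g X X)
    (hDtf : ∀ X Y : L, D X Y - D Y X = ⁅X, Y⁆)
    (hDcodazzi : ∀ X Y Z : L,
      g (D X Y) Z + g Y (D X Z) = g (D Y X) Z + g X (D Y Z))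
    (hDcurv : ∀ X Y Z : L,
      D X (D Y Z) - D Y (D X Z) - D ⁅X, Y⁆ Z = c • (g Y Z • X - g X Z • Y))
    (t : ℝ) (ht : 0 < t) :
    (∀ P Q : (L × ℝ) × (L × ℝ), omegaT g t P (IopH Q) = omegaT g t Q (IopH P))
    ∧ (∀ P : (L × ℝ) × (L × ℝ), P ≠ 0 → 0 < omegaT g t P (IopH P)) := by
  refine ⟨fun P Q => ?_, fun P hP => ?_⟩
  · rw [omegaT_Iop_eq, omegaT_Iop_eq, hgsym P.1.1, hgsym P.2.1]
    ring
  · have hnonneg : ∀ X : L, 0 ≤ g X X := fun X => by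
      rcases eq_or_ne X 0 with rfl | hX
      · simp
      · exact (hgpos X hX).le
    obtain ⟨⟨X, a⟩, ⟨Y, b⟩⟩ := P
    rw [omegaT_Iop_eq]
    have hX := hnonneg X
    have hY := hnonneg Y
    have ha : 0 ≤ t * (a * a) := mul_nonneg ht.le (mul_self_nonneg a)
    have hb : 0 ≤ t * (b * b) := mul_nonneg ht.le (mul_self_nonneg b)
    rw [mul_add]
    by_contra! hle
    dsimp only at hle
    refine hP ?_
    have hX0 : X = 0 := by
      by_contra h
      linarith [hgpos X h]
    have hY0 : Y = 0 := by
      by_contra h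
      linarith [hgpos Y h]
    have ha0 : a = 0 := by
      by_contra h
      linarith [mul_pos ht (mul_self_pos.mpr h)]
    have hb0 : b = 0 := by
      by_contra h
      linarith [mul_pos ht (mul_self_pos.mpr h)]
    simp [hX0, hY0, ha0, hb0]
end

section
/- Let (𝔤, g, D) be a statistical Lie algebra of constant curvature c < 0, let t = −1/c > 0, and keep the notation 𝔥 = 𝔤 × ℝ, ρ = (0,1), ∇, I, π, ρ¹, ρ², ω, ω_t = ω + t·ρ¹∧ρ² of the locally conformally Kähler construction on 𝔥 ⋉_∇ 𝔥ₐ. Then ω_t is closed: dω_t(V₁,V₂,V₃) = −ω_t([V₁,V₂],V₃) + ω_t([V₁,V₃],V₂) − ω_t([V₂,V₃],V₁) = 0 for all V₁,V₂,V₃ ∈ 𝔥 ⊕ 𝔥; hence (𝔥 ⋉_∇ 𝔥ₐ, I, ω_t) is a Kähler Lie algebra. -/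
variable {L : Type*} [LieRing L] [LieAlgebra ℝ L]

/-- For a statistical Lie algebra `(𝔤, g, D)` of constant curvature `c < 0` and `t = −1/c`,
the form `ω_t` on `𝔥 ⋉_∇ 𝔥ₐ` is closed, so `(𝔥 ⋉_∇ 𝔥ₐ, I, ω_t)` is a Kähler Lie algebra. -/
theorem omegaT_closed_of_neg_curv (c : ℝ) (hc : c < 0)
    (D : L →ₗ[ℝ] L →ₗ[ℝ] L) (g : L →ₗ[ℝ] L →ₗ[ℝ] ℝ)
    (hgsym : ∀ X Y : L, g X Y = g Y X)
    (hgpos : ∀ X : L, X ≠ 0 → 0 < g X X)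
    (hDtf : ∀ X Y : L, D X Y - D Y X = ⁅X, Y⁆)
    (hDcodazzi : ∀ X Y Z : L,
      g (D X Y) Z + g Y (D X Z) = g (D Y X) Z + g X (D Y Z))
    (hDcurv : ∀ X Y Z : L,
      D X (D Y Z) - D Y (D X Z) - D ⁅X, Y⁆ Z = c • (g Y Z • X - g X Z • Y))
    (t : ℝ) (ht : t = -1 / c) :
    ∀ V₁ V₂ V₃ : (L × ℝ) × (L × ℝ),
      -omegaT g t (brH D g c V₁ V₂) V₃
        + omegaT g t (brH D g c V₁ V₃) V₂
        - omegaT g t (brH D g c V₂ V₃) V₁ = 0 := by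
  rintro ⟨⟨X₁, a₁⟩, ⟨Y₁, b₁⟩⟩ ⟨⟨X₂, a₂⟩, ⟨Y₂, b₂⟩⟩ ⟨⟨X₃, a₃⟩, ⟨Y₃, b₃⟩⟩
  have htc : t * c = -1 := by
    rw [ht]
    exact div_mul_cancel₀ _ hc.ne
  simp only [omegaT, omegaH, brH, nablaH, IopH, piH, rhoOne, rhoTwo, ← hDtf, Prod.fst_sub,
    Prod.snd_sub, Prod.fst_neg, map_add, map_sub, map_neg, map_smul, LinearMap.add_apply,
    LinearMap.sub_apply, LinearMap.neg_apply, LinearMap.smul_apply, smul_eq_mul]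
  have h₁₂ := hDcodazzi X₁ X₂ Y₃
  have h₁₃ := hDcodazzi X₁ X₃ Y₂
  have h₂₃ := hDcodazzi X₂ X₃ Y₁
  rw [hgsym X₂ (D X₁ Y₃), hgsym X₁ (D X₂ Y₃)] at h₁₂
  rw [hgsym X₃ (D X₁ Y₂), hgsym X₁ (D X₃ Y₂)] at h₁₃
  rw [hgsym X₃ (D X₂ Y₁), hgsym X₂ (D X₃ Y₁)] at h₂₃
  rw [hgsym Y₁ X₂, hgsym Y₁ X₃, hgsym Y₂ X₁, hgsym Y₂ X₃, hgsym Y₃ X₁, hgsym Y₃ X₂,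
    hgsym X₂ X₁, hgsym X₃ X₁, hgsym X₃ X₂]
  linear_combination -h₁₂ + h₁₃ - h₂₃ +
    (a₁ * (g X₃ Y₂ - g X₂ Y₃) + a₂ * (g X₁ Y₃ - g X₃ Y₁) + a₃ * (g X₂ Y₁ - g X₁ Y₂)) * htc
end

section
/- Let (𝔤, g, D) be a statistical Lie algebra of constant curvature c < 0, let t = −1/c > 0, let 𝔥 = 𝔤 × ℝ be the product Lie algebra, ρ = (0,1), and ∇ the connection on 𝔥 given by ∇_X Y = D_X Y − c·g(X,Y)·ρ, ∇_X ρ = ∇_ρ X = X, ∇_ρ ρ = ρ (X,Y ∈ 𝔤). Define the symmetric bilinear form g_t on 𝔥 by g_t((X,a),(Y,b)) = g(X,Y) + t·a·b. Then (𝔥, ∇, g_t) is a Hessian Lie algebra: ∇ is flat and torsion-free, g_t is positive definite, and g_t(∇_A B, C) + g_t(B, ∇_A C) = g_t(∇_B A, C) + g_t(A, ∇_B C) for all A,B,C ∈ 𝔥. -/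
variable {L : Type*} [LieRing L] [LieAlgebra ℝ L]

/-- The symmetric bilinear form `g_t((X,a),(Y,b)) = g(X,Y) + t·a·b` on `𝔥 = 𝔤 × ℝ`. -/
def gT (g : L →ₗ[ℝ] L →ₗ[ℝ] ℝ) (t : ℝ) (A B : L × ℝ) : ℝ :=
  g A.1 B.1 + t * (A.2 * B.2)

/-- For a statistical Lie algebra `(𝔤, g, D)` of constant curvature `c < 0` and `t = −1/c`,
the triple `(𝔥, ∇, g_t)` is a Hessian Lie algebra: `∇` is flat and torsion-free, `g_t` is
positive definite, and the Codazzi condition holds. -/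
theorem hessian_structure_of_neg_curv (c : ℝ) (hc : c < 0)
    (D : L →ₗ[ℝ] L →ₗ[ℝ] L) (g : L →ₗ[ℝ] L →ₗ[ℝ] ℝ)
    (hgsym : ∀ X Y : L, g X Y = g Y X)
    (hgpos : ∀ X : L, X ≠ 0 → 0 < g X X)
    (hDtf : ∀ X Y : L, D X Y - D Y X = ⁅X, Y⁆)
    (hDcodazzi : ∀ X Y Z : L,
      g (D X Y) Z + g Y (D X Z) = g (D Y X) Z + g X (D Y Z))
    (hDcurv : ∀ X Y Z : L,
      D X (D Y Z) - D Y (D X Z) - D ⁅X, Y⁆ Z = c • (g Y Z • X - g X Z • Y))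
    (t : ℝ) (ht : t = -1 / c) :
    (∀ A B : L × ℝ,
      nablaH D g c A B - nablaH D g c B A = (⁅A.1, B.1⁆, (0 : ℝ)))
    ∧ (∀ A B C : L × ℝ,
      nablaH D g c A (nablaH D g c B C) - nablaH D g c B (nablaH D g c A C)
        - nablaH D g c (⁅A.1, B.1⁆, (0 : ℝ)) C = 0)
    ∧ (∀ A : L × ℝ, A ≠ 0 → 0 < gT g t A A)
    ∧ (∀ A B C : L × ℝ,
      gT g t (nablaH D g c A B) C + gT g t B (nablaH D g c A C)
        = gT g t (nablaH D g c B A) C + gT g t A (nablaH D g c B C)) := by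
  have htc : t * c = -1 := by rw [ht, div_mul_cancel₀ _ hc.ne]
  have htpos : 0 < t := ht ▸ div_pos_of_neg_of_neg (by norm_num) hc
  have hgnonneg (X : L) : 0 ≤ g X X := by
    rcases eq_or_ne X 0 with rfl | hX
    · simp
    · exact (hgpos X hX).le
  refine ⟨?_, ?_, ?_, ?_⟩
  · rintro ⟨X, a⟩ ⟨Y, b⟩
    ext
    · simp only [nablaH, Prod.fst_sub, ← hDtf]
      abel
    · simp only [nablaH, Prod.snd_sub, hgsym X Y]
      ring
  · rintro ⟨X, a⟩ ⟨Y, b⟩ ⟨Z, z⟩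
    ext
    · have hcurv := sub_eq_zero.mpr (hDcurv X Y Z)
      simp only [nablaH, Prod.fst_sub, Prod.fst_zero, map_add, map_smul]
      rw [← hcurv, ← hDtf]
      module
    · have hcod := hDcodazzi X Y Z
      simp only [nablaH, Prod.snd_sub, Prod.snd_zero, ← hDtf, map_add, map_sub, map_smul,
        LinearMap.sub_apply, smul_eq_mul]
      linear_combination c * hcod + c * z * hgsym Y X
  · rintro ⟨X, a⟩ hA
    simp only [gT]
    rcases eq_or_ne a 0 with rfl | ha
    · simpa using hgpos X (by rintro rfl; exact hA rfl)
    · exact add_pos_of_nonneg_of_pos (hgnonneg X) (mul_pos htpos (mul_self_pos.mpr ha))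
  · rintro ⟨X, a⟩ ⟨Y, b⟩ ⟨Z, z⟩
    simp only [gT, nablaH, map_add, map_smul, LinearMap.add_apply, LinearMap.smul_apply,
      smul_eq_mul, hgsym Y X]
    linear_combination hDcodazzi X Y Z + (a * g Y Z - b * g X Z) * htc
end
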